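/- Under the setting of the previous statement, if the correlation sequence is square-summable, Σ_{h∈ℤ} ρ_h² < ∞, then limsup_{t→∞} Var(σ̂_t²) ≤ 2σ⁴λ/(2−λ) + 2λσ⁴ Σ_{h∈ℤ} ρ_h². Consequently, as λ → 0 the limiting variance of the EWMA variance estimator tends to 0, and combined with asymptotic unbiasedness the estimator σ̂_t² is consistent for σ². -/

import Mathlib

open MeasureTheory ProbabilityTheory Filter

lemma integral_pow_four_gaussianReal_zero (v : NNReal) :
    ∫ x, x ^ 4 ∂(gaussianReal 0 v) = 3 * (v : ℝ) ^ 2 := by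
  have hmgf : mgf (fun x : ℝ => x) (gaussianReal 0 v) = fun t => Real.exp (v * t ^ 2 / 2) := by
    rw [mgf_fun_id_gaussianReal]
    simp
  have hmoment := iteratedDeriv_mgf_zero (X := fun x : ℝ => x) (μ := gaussianReal 0 v)
    (by simp) 4
  have hexp (t : ℝ) : HasDerivAt (fun t : ℝ => Real.exp (v * t ^ 2 / 2))
      (Real.exp (v * t ^ 2 / 2) * (v * t)) t := by
    have h : HasDerivAt (fun t : ℝ => (v : ℝ) * t ^ 2 / 2) (v * t) t := by
      convert! (((hasDerivAt_id t).pow 2).const_mul (v : ℝ)).div_const 2 using 1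
      simp
      ring
    exact h.exp
  have hd1 : deriv (fun t : ℝ => Real.exp (v * t ^ 2 / 2)) =
      fun t => (v * t) * Real.exp (v * t ^ 2 / 2) := by
    ext t
    rw [(hexp t).deriv, mul_comm]
  have hd2 : deriv (fun t : ℝ => (v * t) * Real.exp (v * t ^ 2 / 2)) =
      fun t => (v + v ^ 2 * t ^ 2) * Real.exp (v * t ^ 2 / 2) := by
    ext t
    have h := ((hasDerivAt_id t).const_mul (v : ℝ)).mul (hexp t)
    refine h.deriv.trans ?_
    simp
    ring
  have hd3 : deriv (fun t : ℝ => (v + v ^ 2 * t ^ 2) * Real.exp (v * t ^ 2 / 2)) =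
      fun t => (3 * v ^ 2 * t + v ^ 3 * t ^ 3) * Real.exp (v * t ^ 2 / 2) := by
    ext t
    have h := ((((hasDerivAt_id t).pow 2).const_mul ((v : ℝ) ^ 2)).const_add (v : ℝ)).mul (hexp t)
    refine h.deriv.trans ?_
    simp
    ring
  have hd4 : deriv (fun t : ℝ => (3 * v ^ 2 * t + v ^ 3 * t ^ 3) * Real.exp (v * t ^ 2 / 2)) 0 =
      3 * (v : ℝ) ^ 2 := by
    have h := (((hasDerivAt_id (0 : ℝ)).const_mul (3 * (v : ℝ) ^ 2)).add
      (((hasDerivAt_id (0 : ℝ)).pow 3).const_mul ((v : ℝ) ^ 3))).mul (hexp 0)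
    refine h.deriv.trans ?_
    simp
  rw [hmgf, iteratedDeriv_succ, iteratedDeriv_succ, iteratedDeriv_succ, iteratedDeriv_one,
    hd1, hd2, hd3, hd4] at hmoment
  simpa using hmoment.symm

section CenteredGaussian

variable {Ω : Type*} [MeasurableSpace Ω] {μ : Measure Ω} {X Y : Ω → ℝ}

lemma memLp_two_mul_of_memLp_four (hX : MemLp X 4 μ) (hY : MemLp Y 4 μ) :
    MemLp (fun ω => X ω * Y ω) 2 μ := by
  have : ENNReal.HolderTriple 4 4 2 := ⟨by
    rw [← two_mul, show (4 : ENNReal) = 2 * 2 by norm_num,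
      ENNReal.mul_inv (by simp) (by simp), ← mul_assoc,
      ENNReal.mul_inv_cancel (by simp) (by simp), one_mul]⟩
  exact hY.mul' hX

lemma integrable_pow_four_of_memLp_four (hX : MemLp X 4 μ) : Integrable (fun ω => X ω ^ 4) μ := by
  have hXX := memLp_two_mul_of_memLp_four hX hX
  exact (hXX.integrable_mul hXX).congr
    (.of_forall fun ω => by simp only [Pi.mul_apply]; ring)

lemma memLp_of_map_eq_gaussianReal {m : ℝ} {v : NNReal} (hX : Measurable X)
    (h : μ.map X = gaussianReal m v) (p : NNReal) : MemLp X p μ := by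
  have hid := memLp_id_gaussianReal (μ := m) (v := v) p
  rw [← h, memLp_map_measure_iff (by fun_prop) hX.aemeasurable] at hid
  exact hid

lemma integral_pow_four_of_map_eq_gaussianReal_zero {v : NNReal} (hX : Measurable X)
    (h : μ.map X = gaussianReal 0 v) :
    ∫ ω, X ω ^ 4 ∂μ = 3 * (∫ ω, X ω ^ 2 ∂μ) ^ 2 := by
  have h4 : ∫ ω, X ω ^ 4 ∂μ = 3 * (v : ℝ) ^ 2 := by
    rw [← integral_pow_four_gaussianReal_zero, ← h, integral_map hX.aemeasurable (by fun_prop)]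
  have h2 : ∫ ω, X ω ^ 2 ∂μ = v := by
    rw [← variance_fun_id_gaussianReal (μ := 0) (v := v),
      variance_of_integral_eq_zero (by fun_prop) (by simp), ← h,
      integral_map hX.aemeasurable (by fun_prop)]
  rw [h4, h2]

/-- The Isserlis formula for the covariance of the squares of two jointly Gaussian centered
variables. -/
lemma covariance_sq_of_gaussian [IsProbabilityMeasure μ] (hX : Measurable X) (hY : Measurable Y)
    (hgauss : ∀ a b : ℝ, ∃ v : NNReal,
      μ.map (fun ω => a * X ω + b * Y ω) = gaussianReal 0 v) :
    cov[fun ω => X ω ^ 2, fun ω => Y ω ^ 2; μ] = 2 * (∫ ω, X ω * Y ω ∂μ) ^ 2 := by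
  obtain ⟨vX, hvX⟩ := hgauss 1 0
  obtain ⟨vY, hvY⟩ := hgauss 0 1
  obtain ⟨vp, hvp⟩ := hgauss 1 1
  obtain ⟨vm, hvm⟩ := hgauss 1 (-1)
  simp only [one_mul, zero_mul, add_zero, zero_add, neg_mul] at hvX hvY hvp hvm
  have mX : MemLp X 4 μ := by exact_mod_cast memLp_of_map_eq_gaussianReal hX hvX 4
  have mY : MemLp Y 4 μ := by exact_mod_cast memLp_of_map_eq_gaussianReal hY hvY 4
  have mXX := memLp_two_mul_of_memLp_four mX mX
  have mXY := memLp_two_mul_of_memLp_four mX mY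
  have mYY := memLp_two_mul_of_memLp_four mY mY
  have iXX := mXX.integrable one_le_two
  have iXY := mXY.integrable one_le_two
  have iYY := mYY.integrable one_le_two
  have hXf := integral_pow_four_of_map_eq_gaussianReal_zero hX hvX
  have hYf := integral_pow_four_of_map_eq_gaussianReal_zero hY hvY
  have hpf := integral_pow_four_of_map_eq_gaussianReal_zero (by fun_prop) hvp
  have hmf := integral_pow_four_of_map_eq_gaussianReal_zero (by fun_prop) hvm
  have hp2 : ∫ ω, (X ω + Y ω) ^ 2 ∂μ =
      ∫ ω, X ω * X ω ∂μ + 2 * ∫ ω, X ω * Y ω ∂μ + ∫ ω, Y ω * Y ω ∂μ := by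
    rw [← integral_const_mul, ← integral_add iXX (iXY.const_mul 2),
      ← integral_add (iXX.fun_add (iXY.const_mul 2)) iYY]
    congr with ω
    ring
  have hm2 : ∫ ω, (X ω + -Y ω) ^ 2 ∂μ =
      ∫ ω, X ω * X ω ∂μ + (-2) * ∫ ω, X ω * Y ω ∂μ + ∫ ω, Y ω * Y ω ∂μ := by
    rw [← integral_const_mul, ← integral_add iXX (iXY.const_mul (-2)),
      ← integral_add (iXX.fun_add (iXY.const_mul (-2))) iYY]
    congr with ω
    ring
  have ip4 : Integrable (fun ω => (X ω + Y ω) ^ 4) μ :=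
    integrable_pow_four_of_memLp_four (mX.add mY)
  have im4 : Integrable (fun ω => (X ω + -Y ω) ^ 4) μ :=
    integrable_pow_four_of_memLp_four (mX.add mY.neg)
  have iX4 := integrable_pow_four_of_memLp_four mX
  have iY4 := integrable_pow_four_of_memLp_four mY
  have iX2Y2 : Integrable (fun ω => X ω ^ 2 * Y ω ^ 2) μ :=
    (mXX.integrable_mul mYY).congr (.of_forall fun ω => by simp only [Pi.mul_apply]; ring)
  have hpolar : ∫ ω, (X ω + Y ω) ^ 4 ∂μ + ∫ ω, (X ω + -Y ω) ^ 4 ∂μ =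
      2 * ∫ ω, X ω ^ 4 ∂μ + 12 * ∫ ω, X ω ^ 2 * Y ω ^ 2 ∂μ + 2 * ∫ ω, Y ω ^ 4 ∂μ := by
    rw [← integral_const_mul, ← integral_const_mul, ← integral_const_mul,
      ← integral_add ip4 im4, ← integral_add (iX4.const_mul 2) (iX2Y2.const_mul 12),
      ← integral_add ((iX4.const_mul 2).fun_add (iX2Y2.const_mul 12)) (iY4.const_mul 2)]
    congr with ω
    ring
  simp only [← sq] at hp2 hm2 mXX mYY
  rw [covariance_eq_sub mXX mYY]
  change ∫ ω, X ω ^ 2 * Y ω ^ 2 ∂μ - (∫ ω, X ω ^ 2 ∂μ) * (∫ ω, Y ω ^ 2 ∂μ) = _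
  rw [hpf, hmf, hXf, hYf, hp2, hm2] at hpolar
  linarith

end CenteredGaussian

lemma sum_geometric_mul_le_tsum {a : ℤ → ℝ} (ha : ∀ h, 0 ≤ a h) (hs : Summable a) {q : ℝ}
    (hq0 : 0 ≤ q) (hq1 : q < 1) (n : ℕ) :
    ∑ i ∈ Finset.range n, ∑ j ∈ Finset.range n, q ^ i * q ^ j * a ((j : ℤ) - i) ≤
      (1 - q)⁻¹ * ∑' h, a h := by
  have hrow (i : ℕ) : ∑ j ∈ Finset.range n, a ((j : ℤ) - i) ≤ ∑' h, a h := by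
    have hinj : Function.Injective fun j : ℕ => (j : ℤ) - i := fun x y hxy => by
      simpa using hxy
    exact (Finset.sum_map (Finset.range n) ⟨_, hinj⟩ a).symm.trans_le
      (hs.sum_le_tsum _ fun h _ => ha h)
  calc ∑ i ∈ Finset.range n, ∑ j ∈ Finset.range n, q ^ i * q ^ j * a ((j : ℤ) - i)
      ≤ ∑ i ∈ Finset.range n, q ^ i * ∑' h, a h := by
        refine Finset.sum_le_sum fun i _ => ?_
        refine le_trans ?_ (mul_le_mul_of_nonneg_left (hrow i) (pow_nonneg hq0 i))
        rw [Finset.mul_sum]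
        refine Finset.sum_le_sum fun j _ => mul_le_mul_of_nonneg_right ?_ (ha _)
        exact mul_le_of_le_one_right (pow_nonneg hq0 i) (pow_le_one₀ hq0 hq1.le)
    _ ≤ (1 - q)⁻¹ * ∑' h, a h := by
        rw [← Finset.sum_mul]
        refine mul_le_mul_of_nonneg_right ?_ (tsum_nonneg ha)
        rw [← tsum_geometric_of_lt_one hq0 hq1]
        exact (summable_geometric_of_lt_one hq0 hq1).sum_le_tsum _ fun i _ => pow_nonneg hq0 i

/-- Under the Gaussian stationary setting, if the autocorrelations are square-summable,
then `limsup_t Var(σ̂_t²) ≤ 2σ⁴λ/(2-λ) + 2λσ⁴ Σ_h ρ_h²`; moreover this bound tends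
to `0` as `λ → 0`, yielding consistency of the EWMA variance estimator. -/
theorem ewma_variance_limsup_bound
    {Ω : Type*} [MeasurableSpace Ω] (μ : Measure Ω) [IsProbabilityMeasure μ]
    (r : ℕ → Ω → ℝ) (sig2 : ℝ) (hsig2 : 0 < sig2) (ρ : ℤ → ℝ)
    (hmeas : ∀ t, Measurable (r t))
    (hGauss : ∀ (s : Finset ℕ) (c : ℕ → ℝ), ∃ v : NNReal,
      Measure.map (fun ω => ∑ t ∈ s, c t * r t ω) μ = gaussianReal 0 v)
    (hmean : ∀ t, ∫ ω, r t ω ∂μ = 0)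
    (hρ0 : ρ 0 = 1)
    (hcov : ∀ s u : ℕ, ∫ ω, r s ω * r u ω ∂μ = sig2 * ρ ((s : ℤ) - (u : ℤ)))
    (hsum : Summable fun h : ℤ => (ρ h) ^ 2)
    (lam : ℝ) (hlam : lam ∈ Set.Ioo (0 : ℝ) 1) :
    (limsup (fun t : ℕ => variance (fun ω => ∑ j ∈ Finset.range (t + 1),
          lam * (1 - lam) ^ j * (r (t - j) ω) ^ 2) μ) atTop
        ≤ 2 * sig2 ^ 2 * lam / (2 - lam) + 2 * lam * sig2 ^ 2 * ∑' h : ℤ, (ρ h) ^ 2) ∧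
    Tendsto (fun l : ℝ => 2 * sig2 ^ 2 * l / (2 - l)
        + 2 * l * sig2 ^ 2 * ∑' h : ℤ, (ρ h) ^ 2)
      (nhdsWithin 0 (Set.Ioi 0)) (nhds 0) := by
  obtain ⟨hl0, hl1⟩ := hlam
  have hpair (s u : ℕ) (a b : ℝ) : ∃ v : NNReal,
      μ.map (fun ω => a * r s ω + b * r u ω) = gaussianReal 0 v := by
    obtain ⟨v, hv⟩ := hGauss {s, u}
      (fun t => (if t = s then a else 0) + (if t = u then b else 0))
    refine ⟨v, ?_⟩
    rw [← hv]
    congr with ω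
    simp [add_mul, Finset.sum_add_distrib]
  have hmemLp (s : ℕ) : MemLp (fun ω => r s ω ^ 2) 2 μ := by
    obtain ⟨v, hv⟩ := hpair s s 1 0
    simp only [one_mul, zero_mul, add_zero] at hv
    have h4 : MemLp (r s) 4 μ := by
      exact_mod_cast memLp_of_map_eq_gaussianReal (hmeas s) hv 4
    simpa only [← sq] using memLp_two_mul_of_memLp_four h4 h4
  have hS : 0 ≤ ∑' h : ℤ, ρ h ^ 2 := tsum_nonneg fun h => sq_nonneg _
  have hvar (t : ℕ) : variance (fun ω => ∑ j ∈ Finset.range (t + 1),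
      lam * (1 - lam) ^ j * (r (t - j) ω) ^ 2) μ =
      2 * sig2 ^ 2 * lam ^ 2 * ∑ i ∈ Finset.range (t + 1), ∑ j ∈ Finset.range (t + 1),
        (1 - lam) ^ i * (1 - lam) ^ j * ρ ((j : ℤ) - i) ^ 2 := by
    rw [variance_fun_sum' fun j _ => (hmemLp (t - j)).const_mul _, Finset.mul_sum]
    refine Finset.sum_congr rfl fun i hi => ?_
    rw [Finset.mul_sum]
    refine Finset.sum_congr rfl fun j hj => ?_
    rw [Finset.mem_range] at hi hj
    rw [covariance_const_mul_left, covariance_const_mul_right,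
      covariance_sq_of_gaussian (hmeas _) (hmeas _) (hpair _ _), hcov,
      show ((t - i : ℕ) : ℤ) - ((t - j : ℕ) : ℤ) = (j : ℤ) - i by omega]
    ring
  refine ⟨?_, ?_⟩
  · refine limsup_le_of_le ?_ (.of_forall fun t => ?_)
    · exact (isBoundedUnder_of ⟨0, fun t => variance_nonneg _ _⟩ :
        IsBoundedUnder (· ≥ ·) atTop _).isCoboundedUnder_le
    · have hsum_le := sum_geometric_mul_le_tsum (fun h => sq_nonneg (ρ h)) hsum
        (by linarith : 0 ≤ 1 - lam) (by linarith) (t + 1)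
      rw [sub_sub_cancel] at hsum_le
      have hdiag : 0 ≤ 2 * sig2 ^ 2 * lam / (2 - lam) :=
        div_nonneg (by positivity) (by linarith)
      rw [hvar]
      calc _ ≤ 2 * sig2 ^ 2 * lam ^ 2 * (lam⁻¹ * ∑' h : ℤ, ρ h ^ 2) := by gcongr
        _ = 2 * lam * sig2 ^ 2 * ∑' h : ℤ, ρ h ^ 2 := by field_simp
        _ ≤ _ := le_add_of_nonneg_left hdiag
  · have hcont : ContinuousAt (fun l : ℝ => 2 * sig2 ^ 2 * l / (2 - l)
        + 2 * l * sig2 ^ 2 * ∑' h : ℤ, (ρ h) ^ 2) 0 := by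
      fun_prop (disch := norm_num)
    simpa using hcont.tendsto.mono_left nhdsWithin_le_nhds
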